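/- arXiv:1201.3027 — 3 statements merged into one kernel-verified Lean document; each statement's English description precedes it below -/
import Mathlib

section
/- Let p ≥ 0 be an integer and ζ a real random variable with E{ζ} = 0 and E{|ζ|^{p+2}} < ∞, and let κ₁,…,κ_{p+1} denote its cumulants. Let Φ : ℝ → ℂ be of class C^{p+1} with bounded derivatives Φ^{(l)}, l = 1,…,p+1. Then E{ζ Φ(ζ)} = Σ_{l=0}^{p} (κ_{l+1}/l!) · E{Φ^{(l)}(ζ)} + ε_p, where the remainder satisfies |ε_p| ≤ C_p · E{|ζ|^{p+2}} · sup_{t∈ℝ} |Φ^{(p+1)}(t)| with the constant C_p = (1 + (3+2p)^{p+2})/(p+1)!. -/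
open MeasureTheory ProbabilityTheory Complex Finset

/-- The `j`-th cumulant of a real random variable `ζ` on a probability space `(Ω, ℙ)`:
`κ_j = i^{-j} (d^j/dt^j) log E{e^{itζ}} |_{t=0}` (principal branch of the logarithm). -/
noncomputable def cumulant {Ω : Type*} [MeasureSpace Ω] (ζ : Ω → ℝ) (j : ℕ) : ℂ :=
  iteratedDeriv j (fun t : ℝ => Complex.log (∫ ω, Complex.exp (Complex.I * t * ζ ω))) 0
    / Complex.I ^ j

/-- Taylor's theorem at `0` with the sharp Lagrange bound on the remainder. -/
theorem norm_sub_taylor_sum_le (n : ℕ) {g : ℝ → ℂ} (hg : ContDiff ℝ n g) {M : ℝ}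
    (hM : ∀ t, ‖iteratedDeriv n g t‖ ≤ M) (x : ℝ) :
    ‖g x - ∑ k ∈ range n, iteratedDeriv k g 0 * ((x : ℂ) ^ k / (k.factorial : ℂ))‖
      ≤ M * (|x| ^ n / (n.factorial : ℝ)) := by
  induction n generalizing g x with
  | zero => simpa using hM x
  | succ n ih =>
    have hg' : ContDiff ℝ n (deriv g) := (contDiff_succ_iff_deriv.mp hg).2.2
    have hr := ih hg' (by simpa [iteratedDeriv_succ'] using hM)
    have hd : ∀ y : ℝ, HasDerivAt (fun y : ℝ => g y - ∑ k ∈ range (n + 1),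
        iteratedDeriv k g 0 * ((y : ℂ) ^ k / (k.factorial : ℂ)))
        (deriv g y - ∑ k ∈ range n,
          iteratedDeriv k (deriv g) 0 * ((y : ℂ) ^ k / (k.factorial : ℂ))) y := by
      intro y
      refine HasDerivAt.sub ((hg.differentiable (by simp)) y).hasDerivAt ?_
      simp_rw [sum_range_succ' _ n]
      have : HasDerivAt (fun y : ℝ => ∑ k ∈ range n,
        iteratedDeriv (k + 1) g 0 * ((y : ℂ) ^ (k + 1) / ((k + 1).factorial : ℂ)))
          (∑ k ∈ range n,
          iteratedDeriv k (deriv g) 0 * ((y : ℂ) ^ k / (k.factorial : ℂ))) y := by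
        refine HasDerivAt.fun_sum fun k _ => ?_
        rw [iteratedDeriv_succ']
        refine HasDerivAt.const_mul _ ?_
        have h := (((hasDerivAt_id y).ofReal_comp).pow (k + 1)).div_const
          (((k + 1).factorial : ℂ))
        convert! h using 1
        have h1 : (k.factorial : ℂ) ≠ 0 := by exact_mod_cast k.factorial_ne_zero
        have h2 : ((k : ℂ) + 1) ≠ 0 := by exact_mod_cast k.succ_ne_zero
        simp [Nat.factorial_succ]
        field_simp
      simpa using this.add_const (g 0)
    have hF : ∀ t : ℝ, HasDerivAt (fun t : ℝ => g (t * x) - ∑ k ∈ range (n + 1),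
        iteratedDeriv k g 0 * (((t * x : ℝ) : ℂ) ^ k / (k.factorial : ℂ)))
        (x • (deriv g (t * x) - ∑ k ∈ range n,
          iteratedDeriv k (deriv g) 0 * (((t * x : ℝ) : ℂ) ^ k / (k.factorial : ℂ)))) t := by
      intro t
      have := (hd (t * x)).scomp t ((hasDerivAt_id t).mul_const x)
      simpa [Function.comp_def] using! this
    have hB : ∀ t : ℝ, HasDerivAt
        (fun t : ℝ => M * (|x| ^ (n + 1) / ((n + 1).factorial : ℝ)) * t ^ (n + 1))
        (|x| * (M * ((t * |x|) ^ n / (n.factorial : ℝ)))) t := by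
      intro t
      have h := (hasDerivAt_pow (n + 1) t).const_mul
        (M * (|x| ^ (n + 1) / ((n + 1).factorial : ℝ)))
      refine h.congr_deriv ?_
      have h1 : (n.factorial : ℝ) ≠ 0 := by exact_mod_cast n.factorial_ne_zero
      have h2 : ((n : ℝ) + 1) ≠ 0 := by positivity
      simp [Nat.factorial_succ]
      field_simp
      ring
    have := image_norm_le_of_norm_deriv_right_le_deriv_boundary (a := 0) (b := 1)
      (fun t _ => (hF t).continuousAt.continuousWithinAt)
      (fun t _ => (hF t).hasDerivWithinAt) (by simp [sum_range_succ']) hB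
      (fun t ht => by
        rw [norm_smul, Real.norm_eq_abs]
        refine mul_le_mul_of_nonneg_left ((hr (t * x)).trans_eq ?_) (abs_nonneg x)
        rw [abs_mul, abs_of_nonneg ht.1]) (Set.right_mem_Icc.2 zero_le_one)
    simpa using this

/-- Absolute moments satisfy `E|ζ|^a · E|ζ|^b ≤ E|ζ|^(a+b)`. -/
theorem integral_abs_pow_mul_le {Ω : Type*} [MeasurableSpace Ω] {μ : Measure Ω}
    [IsProbabilityMeasure μ] {ζ : Ω → ℝ} {a b : ℕ}
    (ha : Integrable (fun ω => |ζ ω| ^ a) μ) (hb : Integrable (fun ω => |ζ ω| ^ b) μ)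
    (hab : Integrable (fun ω => |ζ ω| ^ (a + b)) μ) :
    (∫ ω, |ζ ω| ^ a ∂μ) * (∫ ω, |ζ ω| ^ b ∂μ) ≤ ∫ ω, |ζ ω| ^ (a + b) ∂μ := by
  rcases Nat.eq_zero_or_pos a with rfl | ha0
  · simp
  have hnn : 0 ≤ ∫ ω, |ζ ω| ^ a ∂μ := integral_nonneg fun ω => by positivity
  obtain ⟨c, hc0, hc⟩ : ∃ c : ℝ, 0 ≤ c ∧ c ^ a = ∫ ω, |ζ ω| ^ a ∂μ :=
    ⟨_, Real.rpow_nonneg hnn _, Real.rpow_inv_natCast_pow hnn ha0.ne'⟩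
  have key : ∀ ω, c ^ a * |ζ ω| ^ b + c ^ b * |ζ ω| ^ a - c ^ a * c ^ b ≤ |ζ ω| ^ (a + b) := by
    intro ω
    have : 0 ≤ (|ζ ω| ^ a - c ^ a) * (|ζ ω| ^ b - c ^ b) := by
      rcases le_total c |ζ ω| with h | h
      · exact mul_nonneg (sub_nonneg.2 (by gcongr)) (sub_nonneg.2 (by gcongr))
      · exact mul_nonneg_of_nonpos_of_nonpos (sub_nonpos.2 (by gcongr))
          (sub_nonpos.2 (by gcongr))
    rw [pow_add]
    linarith
  have hia := ha.const_mul (c ^ b)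
  have hib := hb.const_mul (c ^ a)
  have hi : Integrable (fun ω => c ^ a * |ζ ω| ^ b + c ^ b * |ζ ω| ^ a) μ := hib.add hia
  have h := integral_mono (hi.sub (integrable_const (c ^ a * c ^ b))) hab key
  rw [integral_sub' hi (integrable_const _), integral_add hib hia, integral_const_mul,
    integral_const_mul, integral_const] at h
  simp only [probReal_univ, one_smul, ← hc] at h ⊢
  linarith

/-- The recursion expressing the moments through lower moments and cumulants. -/
theorem integral_pow_succ_eq_sum_cumulant {Ω : Type*} [MeasureSpace Ω]
    [IsProbabilityMeasure (ℙ : Measure Ω)] {ζ : Ω → ℝ} (hmeas : Measurable ζ) {n : ℕ}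
    (hmom : MemLp ζ (n + 1 : ℕ) ℙ) :
    ∫ ω, (ζ ω : ℂ) ^ (n + 1) = ∑ l ∈ range (n + 1),
      (n.choose l : ℂ) * cumulant ζ (l + 1) * ∫ ω, (ζ ω : ℂ) ^ (n - l) := by
  have hae : AEMeasurable ζ ℙ := hmeas.aemeasurable
  set ν : Measure ℝ := Measure.map ζ ℙ with hν
  have : IsProbabilityMeasure ν := Measure.isProbabilityMeasure_map hae
  have hmem : ∀ k : ℕ, k ≤ n + 1 → MemLp id (k : ℕ) ν := fun k hk =>
    MemLp.mono_exponent ((memLp_map_measure_iff aestronglyMeasurable_id hae).2 hmom)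
      (by exact_mod_cast hk)
  have hf : (fun t : ℝ => ∫ ω, cexp (I * t * ζ ω)) = charFun ν := by
    ext t
    rw [charFun_apply_real, hν, integral_map hae (by fun_prop)]
    refine integral_congr_ae (.of_forall fun ω => ?_)
    simp only
    congr 1
    ring
  have hder : ∀ k ≤ n + 1, iteratedDeriv k (charFun ν) 0 = I ^ k * ∫ ω, (ζ ω : ℂ) ^ k := by
    intro k hk
    rw [iteratedDeriv_charFun (hmem k hk), hν, integral_map hae (by fun_prop)]
    simp
  set L : ℝ → ℂ := fun t => Complex.log (charFun ν t) with hL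
  have hcum : ∀ k, iteratedDeriv k L 0 = I ^ k * cumulant ζ k := by
    intro k
    rw [cumulant, mul_div_cancel₀ _ (pow_ne_zero _ I_ne_zero)]
    exact congrArg (fun f : ℝ → ℂ => iteratedDeriv k (fun t => Complex.log (f t)) 0) hf.symm
  have hC : ContDiff ℝ (n + 1 : ℕ) (charFun ν) := contDiff_charFun (hmem _ le_rfl)
  have hslit : ∀ᶠ t in nhds (0 : ℝ), charFun ν t ∈ slitPlane :=
    hC.continuous.continuousAt.eventually_mem (isOpen_slitPlane.mem_nhds (by simp))
  have hLC : ContDiffAt ℝ (n + 1 : ℕ) L 0 :=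
    ((contDiffAt_log (x := charFun ν 0) (by simp)).restrict_scalars ℝ).comp (0 : ℝ) hC.contDiffAt
  have hL' : ContDiffAt ℝ n (deriv L) 0 := hLC.derivWithin (by norm_cast)
  have hprod : deriv (charFun ν) =ᶠ[nhds 0] fun t => deriv L t * charFun ν t := by
    filter_upwards [hslit] with t ht
    have := ((hC.differentiable (by simp)) t).hasDerivAt.clog_real ht
    rw [hL, this.deriv, div_mul_cancel₀ _ (slitPlane_ne_zero ht)]
  have h := hprod.iteratedDeriv_eq n
  rw [← iteratedDeriv_succ', iteratedDeriv_fun_mul hL'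
    (hC.contDiffAt.of_le (by norm_cast; omega)), hder _ le_rfl] at h
  refine mul_left_cancel₀ (pow_ne_zero (n + 1) I_ne_zero) (h.trans ?_)
  rw [mul_sum]
  refine sum_congr rfl fun l hl => ?_
  have hl' : l ≤ n := Nat.lt_succ_iff.1 (mem_range.1 hl)
  rw [← iteratedDeriv_succ', hcum, hder _ (by omega),
    show n + 1 = (l + 1) + (n - l) by omega, pow_add I (l + 1)]
  ring_nf

theorem sum_range_choose_mul_succ_pow_le (n : ℕ) :
    ∑ l ∈ range n, (n.choose l : ℝ) * ((l : ℝ) + 1) ^ (l + 1) ≤ n * ((n : ℝ) + 1) ^ n := by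
  calc ∑ l ∈ range n, (n.choose l : ℝ) * ((l : ℝ) + 1) ^ (l + 1)
      ≤ ∑ l ∈ range n, (n.choose l : ℝ) * (n : ℝ) ^ (l + 1) := by
        refine sum_le_sum fun l hl => ?_
        have : (l : ℝ) + 1 ≤ n := by exact_mod_cast mem_range.1 hl
        gcongr
    _ ≤ ∑ l ∈ range (n + 1), (n.choose l : ℝ) * (n : ℝ) ^ (l + 1) :=
        sum_le_sum_of_subset_of_nonneg (range_subset_range.2 n.le_succ)
          fun _ _ _ => by positivity
    _ = n * ((n : ℝ) + 1) ^ n := by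
        rw [add_pow, mul_sum]
        refine sum_congr rfl fun l _ => ?_
        ring

theorem integrable_abs_pow {Ω : Type*} [MeasurableSpace Ω] {μ : Measure Ω} [IsFiniteMeasure μ]
    {ζ : Ω → ℝ} {N k : ℕ} (h : MemLp ζ N μ) (hk : k ≤ N) :
    Integrable (fun ω => |ζ ω| ^ k) μ := by
  simpa using (h.mono_exponent (p := k) (by exact_mod_cast hk)).integrable_norm_pow'

theorem norm_integral_ofReal_pow_le {Ω : Type*} [MeasurableSpace Ω] {μ : Measure Ω}
    (ζ : Ω → ℝ) (k : ℕ) : ‖∫ ω, (ζ ω : ℂ) ^ k ∂μ‖ ≤ ∫ ω, |ζ ω| ^ k ∂μ := by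
  simpa using norm_integral_le_integral_norm (μ := μ) fun ω => (ζ ω : ℂ) ^ k

/-- The `j`-th cumulant is bounded by `j^j E|ζ|^j`. -/
theorem norm_cumulant_succ_le {Ω : Type*} [MeasureSpace Ω]
    [IsProbabilityMeasure (ℙ : Measure Ω)] {ζ : Ω → ℝ} (hmeas : Measurable ζ) (n : ℕ)
    (hmom : MemLp ζ (n + 1 : ℕ) ℙ) :
    ‖cumulant ζ (n + 1)‖ ≤ ((n : ℝ) + 1) ^ (n + 1) * ∫ ω, |ζ ω| ^ (n + 1) := by
  induction n using Nat.strong_induction_on with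
  | _ n ih =>
    have hrec := integral_pow_succ_eq_sum_cumulant hmeas hmom
    rw [sum_range_succ] at hrec
    simp only [Nat.choose_self, Nat.cast_one, one_mul, Nat.sub_self, pow_zero, integral_const,
      probReal_univ, one_smul, mul_one] at hrec
    have hA : 0 ≤ ∫ ω, |ζ ω| ^ (n + 1) := integral_nonneg fun ω => by positivity
    have hterm : ∀ l ∈ range n,
        ‖(n.choose l : ℂ) * cumulant ζ (l + 1) * ∫ ω, (ζ ω : ℂ) ^ (n - l)‖
          ≤ (n.choose l : ℝ) * ((l : ℝ) + 1) ^ (l + 1) * ∫ ω, |ζ ω| ^ (n + 1) := by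
      intro l hl
      have hl := mem_range.1 hl
      have h1 := ih l hl (hmom.mono_exponent (by exact_mod_cast (by omega : l + 1 ≤ n + 1)))
      have h2 := integral_abs_pow_mul_le (a := l + 1) (b := n - l)
        (integrable_abs_pow hmom (by omega)) (integrable_abs_pow hmom (by omega))
        (integrable_abs_pow hmom (by omega))
      rw [show l + 1 + (n - l) = n + 1 by omega] at h2
      rw [norm_mul, norm_mul, Complex.norm_natCast]
      calc (n.choose l : ℝ) * ‖cumulant ζ (l + 1)‖ * ‖∫ ω, (ζ ω : ℂ) ^ (n - l)‖
          ≤ (n.choose l : ℝ) * (((l : ℝ) + 1) ^ (l + 1) * ∫ ω, |ζ ω| ^ (l + 1))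
              * ∫ ω, |ζ ω| ^ (n - l) := by
            gcongr
            exact norm_integral_ofReal_pow_le _ _
        _ = (n.choose l : ℝ) * ((l : ℝ) + 1) ^ (l + 1)
              * ((∫ ω, |ζ ω| ^ (l + 1)) * ∫ ω, |ζ ω| ^ (n - l)) := by ring
        _ ≤ _ := by gcongr
    calc ‖cumulant ζ (n + 1)‖
        = ‖(∫ ω, (ζ ω : ℂ) ^ (n + 1))
            - ∑ l ∈ range n, (n.choose l : ℂ) * cumulant ζ (l + 1)
              * ∫ ω, (ζ ω : ℂ) ^ (n - l)‖ := by rw [hrec, add_sub_cancel_left]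
      _ ≤ (∫ ω, |ζ ω| ^ (n + 1)) + ∑ l ∈ range n,
            (n.choose l : ℝ) * ((l : ℝ) + 1) ^ (l + 1) * ∫ ω, |ζ ω| ^ (n + 1) :=
          (norm_sub_le _ _).trans
            (add_le_add (norm_integral_ofReal_pow_le _ _) (norm_sum_le_of_le _ hterm))
      _ = (1 + ∑ l ∈ range n, (n.choose l : ℝ) * ((l : ℝ) + 1) ^ (l + 1))
            * ∫ ω, |ζ ω| ^ (n + 1) := by rw [← sum_mul]; ring
      _ ≤ ((n : ℝ) + 1) ^ (n + 1) * ∫ ω, |ζ ω| ^ (n + 1) := by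
          gcongr
          have h1 := sum_range_choose_mul_succ_pow_le n
          have h2 : (1 : ℝ) ≤ ((n : ℝ) + 1) ^ n := one_le_pow₀ (by simp)
          rw [pow_succ]
          linarith

/-- The cumulant expansion is exact for polynomials of degree less than `n`. -/
theorem integral_mul_taylor_sum_eq {Ω : Type*} [MeasureSpace Ω]
    [IsProbabilityMeasure (ℙ : Measure Ω)] {ζ : Ω → ℝ} (hmeas : Measurable ζ) (n : ℕ)
    (hmom : MemLp ζ n ℙ) (c : ℕ → ℂ) :
    ∫ ω, (ζ ω : ℂ) * ∑ k ∈ range n, c k * ((ζ ω : ℂ) ^ k / (k.factorial : ℂ))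
      = ∑ l ∈ range n, cumulant ζ (l + 1) / (l.factorial : ℂ)
          * ∫ ω, ∑ k ∈ range (n - l), c (l + k) * ((ζ ω : ℂ) ^ k / (k.factorial : ℂ)) := by
  have hint : ∀ k ≤ n, Integrable (fun ω => (ζ ω : ℂ) ^ k) := fun k hk =>
    (integrable_norm_iff (by fun_prop)).1 (by simpa using integrable_abs_pow hmom hk)
  have hl : ∀ l ∈ range n, cumulant ζ (l + 1) / (l.factorial : ℂ)
        * ∫ ω, ∑ k ∈ range (n - l), c (l + k) * ((ζ ω : ℂ) ^ k / (k.factorial : ℂ))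
      = ∑ k ∈ range (n - l), cumulant ζ (l + 1) / (l.factorial : ℂ)
        * (c (l + k) * ((∫ ω, (ζ ω : ℂ) ^ k) / (k.factorial : ℂ))) := by
    intro l _
    rw [integral_finsetSum _ fun k hk => ((hint k (by grind)).div_const _).const_mul _, mul_sum]
    simp_rw [integral_const_mul, integral_div]
  rw [sum_congr rfl hl, ← sum_range_diag_flip n fun l k => cumulant ζ (l + 1) / (l.factorial : ℂ)
        * (c (l + k) * ((∫ ω, (ζ ω : ℂ) ^ k) / (k.factorial : ℂ)))]
  have hpow : ∀ ω, (ζ ω : ℂ) * ∑ k ∈ range n, c k * ((ζ ω : ℂ) ^ k / (k.factorial : ℂ))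
      = ∑ k ∈ range n, c k * ((ζ ω : ℂ) ^ (k + 1) / (k.factorial : ℂ)) := fun ω => by
    rw [mul_sum]
    exact sum_congr rfl fun k _ => by ring
  simp_rw [hpow]
  rw [integral_finsetSum _ fun k hk => ((hint (k + 1) (by grind)).div_const _).const_mul _]
  refine sum_congr rfl fun m hm => ?_
  rw [integral_const_mul, integral_div, integral_pow_succ_eq_sum_cumulant hmeas
    (hmom.mono_exponent (by exact_mod_cast mem_range.1 hm)), sum_div, mul_sum]
  refine sum_congr rfl fun l hl => ?_
  have hl : l ≤ m := Nat.lt_succ_iff.1 (mem_range.1 hl)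
  rw [Nat.cast_choose ℂ hl, Nat.add_sub_cancel' hl]
  have h1 : (m.factorial : ℂ) ≠ 0 := by exact_mod_cast m.factorial_ne_zero
  field_simp

theorem iteratedDeriv_iteratedDeriv (k l : ℕ) (f : ℝ → ℂ) :
    iteratedDeriv k (iteratedDeriv l f) = iteratedDeriv (k + l) f := by
  simp_rw [iteratedDeriv_eq_iterate, Function.iterate_add_apply]

/-- Cumulant expansion (finite order with remainder): if `E{ζ} = 0`, `E{|ζ|^{p+2}} < ∞` and
`Φ ∈ C^{p+1}` has bounded derivatives `Φ^{(l)}`, `l = 1,…,p+1`, then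
`E{ζΦ(ζ)} = Σ_{l=0}^p (κ_{l+1}/l!) E{Φ^{(l)}(ζ)} + ε_p` with
`|ε_p| ≤ C_p E{|ζ|^{p+2}} sup_t |Φ^{(p+1)}(t)|`, `C_p = (1+(3+2p)^{p+2})/(p+1)!`. -/
theorem cumulant_expansion
    {Ω : Type*} [MeasureSpace Ω] [IsProbabilityMeasure (ℙ : Measure Ω)]
    (p : ℕ) (ζ : Ω → ℝ) (hmeas : Measurable ζ)
    (hmom : Integrable (fun ω => |ζ ω| ^ (p + 2)))
    (hcen : ∫ ω, ζ ω = 0)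
    (Φ : ℝ → ℂ) (hΦ : ContDiff ℝ (p + 1) Φ)
    (hbdd : ∀ l : ℕ, 1 ≤ l → l ≤ p + 1 → ∃ B : ℝ, ∀ t : ℝ, ‖iteratedDeriv l Φ t‖ ≤ B) :
    ‖(∫ ω, (ζ ω : ℂ) * Φ (ζ ω))
        - ∑ l ∈ range (p + 1), cumulant ζ (l + 1) / (l.factorial : ℂ)
            * ∫ ω, iteratedDeriv l Φ (ζ ω)‖
      ≤ (1 + (3 + 2 * (p : ℝ)) ^ (p + 2)) / ((p + 1).factorial : ℝ)
          * (∫ ω, |ζ ω| ^ (p + 2)) * ⨆ t : ℝ, ‖iteratedDeriv (p + 1) Φ t‖ := by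

  set M : ℝ := ⨆ t : ℝ, ‖iteratedDeriv (p + 1) Φ t‖
  have hM : ∀ t, ‖iteratedDeriv (p + 1) Φ t‖ ≤ M := by
    obtain ⟨B, hB⟩ := hbdd (p + 1) (by omega) le_rfl
    exact le_ciSup (f := fun t => ‖iteratedDeriv (p + 1) Φ t‖) ⟨B, Set.forall_mem_range.2 hB⟩
  have hM0 : 0 ≤ M := (norm_nonneg _).trans (hM 0)
  have hLp : MemLp ζ (p + 2 : ℕ) ℙ := by
    refine (integrable_norm_rpow_iff hmeas.aestronglyMeasurable (by simp) (by simp)).1 ?_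
    simpa only [ENNReal.toReal_natCast, Real.rpow_natCast, Real.norm_eq_abs] using hmom
  set T : ℕ → Ω → ℂ := fun l ω => ∑ k ∈ range (p + 1 - l),
    iteratedDeriv (l + k) Φ 0 * ((ζ ω : ℂ) ^ k / (k.factorial : ℂ)) with hT
  have hcont : ∀ l ≤ p + 1, ContDiff ℝ (p + 1 - l : ℕ) (iteratedDeriv l Φ) := by
    intro l hl
    rw [iteratedDeriv_eq_iterate]
    refine ContDiff.iterate_deriv' _ _ ?_
    rw [Nat.sub_add_cancel hl]
    exact_mod_cast hΦ
  have hR : ∀ l ≤ p + 1, ∀ ω, ‖iteratedDeriv l Φ (ζ ω) - T l ω‖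
      ≤ M * (|ζ ω| ^ (p + 1 - l) / ((p + 1 - l).factorial : ℝ)) := by
    intro l hl ω
    have h := norm_sub_taylor_sum_le (p + 1 - l) (hcont l hl) (M := M)
      (by rw [iteratedDeriv_iteratedDeriv, Nat.sub_add_cancel hl]; exact hM) (ζ ω)
    simpa only [iteratedDeriv_iteratedDeriv, add_comm _ l] using h
  have hTint : ∀ l, Integrable (T l) := fun l =>
    integrable_finsetSum _ fun k hk => Integrable.const_mul (Integrable.div_const
      ((integrable_norm_iff (by fun_prop)).1
        (by simpa using integrable_abs_pow hLp (k := k) (by grind))) _) _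
  have hΦm : ∀ l ≤ p + 1, Measurable fun ω => iteratedDeriv l Φ (ζ ω) := fun l hl =>
    (hcont l hl).continuous.measurable.comp hmeas
  have hTm : ∀ l, Measurable (T l) := fun l => by fun_prop
  have hRint : ∀ l ≤ p + 1, Integrable fun ω => iteratedDeriv l Φ (ζ ω) - T l ω :=
    fun l hl => Integrable.mono'
      (((integrable_abs_pow hLp (k := p + 1 - l) (by omega)).div_const _).const_mul M)
      ((hΦm l hl).sub (hTm l)).aestronglyMeasurable (.of_forall (hR l hl))
  have hR0 : ∀ ω, ‖(ζ ω : ℂ) * (Φ (ζ ω) - T 0 ω)‖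
      ≤ M / ((p + 1).factorial : ℝ) * |ζ ω| ^ (p + 2) := by
    intro ω
    have h := hR 0 (by omega) ω
    rw [iteratedDeriv_zero, Nat.sub_zero] at h
    rw [norm_mul, Complex.norm_real, Real.norm_eq_abs]
    refine (mul_le_mul_of_nonneg_left h (abs_nonneg _)).trans_eq ?_
    ring
  have hR0int : Integrable fun ω => (ζ ω : ℂ) * (Φ (ζ ω) - T 0 ω) :=
    Integrable.mono' (hmom.const_mul (M / ((p + 1).factorial : ℝ)))
      ((measurable_ofReal.comp hmeas).mul
        ((hΦm 0 (by omega)).sub (hTm 0))).aestronglyMeasurable (.of_forall hR0)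
  have hT0int : Integrable fun ω => (ζ ω : ℂ) * T 0 ω := by
    simp only [hT, mul_sum]
    refine integrable_finsetSum _ fun k hk => ?_
    have : Integrable fun ω => (ζ ω : ℂ) ^ (k + 1) := (integrable_norm_iff (by fun_prop)).1
      (by simpa using integrable_abs_pow hLp (k := k + 1) (by grind))
    exact (this.const_mul (iteratedDeriv (0 + k) Φ 0 / (k.factorial : ℂ))).congr
      (.of_forall fun ω => by ring)
  have hpoly : ∫ ω, (ζ ω : ℂ) * T 0 ω = ∑ l ∈ range (p + 1),
      cumulant ζ (l + 1) / (l.factorial : ℂ) * ∫ ω, T l ω := by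
    simpa [hT] using integral_mul_taylor_sum_eq hmeas (p + 1)
      (hLp.mono_exponent (by exact_mod_cast Nat.le_succ _)) fun k => iteratedDeriv k Φ 0
  have hfirst : ∫ ω, (ζ ω : ℂ) * Φ (ζ ω)
      = (∫ ω, (ζ ω : ℂ) * (Φ (ζ ω) - T 0 ω)) + ∫ ω, (ζ ω : ℂ) * T 0 ω := by
    rw [← integral_add hR0int hT0int]
    congr with ω
    ring
  have hrest : ∀ l ∈ range (p + 1), ∫ ω, iteratedDeriv l Φ (ζ ω)
      = (∫ ω, (iteratedDeriv l Φ (ζ ω) - T l ω)) + ∫ ω, T l ω := by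
    intro l hl
    rw [← integral_add (hRint l (mem_range.1 hl).le) (hTint l)]
    simp
  have hdiff : (∫ ω, (ζ ω : ℂ) * Φ (ζ ω))
        - ∑ l ∈ range (p + 1), cumulant ζ (l + 1) / (l.factorial : ℂ)
            * ∫ ω, iteratedDeriv l Φ (ζ ω)
      = (∫ ω, (ζ ω : ℂ) * (Φ (ζ ω) - T 0 ω))
        - ∑ l ∈ range (p + 1), cumulant ζ (l + 1) / (l.factorial : ℂ)
            * ∫ ω, (iteratedDeriv l Φ (ζ ω) - T l ω) := by
    rw [sum_congr rfl fun l hl => congrArg _ (hrest l hl), hfirst, hpoly]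
    simp_rw [mul_add, sum_add_distrib]
    ring
  set A : ℝ := ∫ ω, |ζ ω| ^ (p + 2) with hA
  have hA0 : 0 ≤ A := integral_nonneg fun ω => by positivity
  have hterm : ∀ l ∈ range (p + 1), ‖cumulant ζ (l + 1) / (l.factorial : ℂ)
        * ∫ ω, (iteratedDeriv l Φ (ζ ω) - T l ω)‖
      ≤ ((p + 1).choose l : ℝ) * ((l : ℝ) + 1) ^ (l + 1)
          * (M * A / ((p + 1).factorial : ℝ)) := by
    intro l hl
    have hl := mem_range.1 hl
    have h1 := norm_cumulant_succ_le hmeas l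
      (hLp.mono_exponent (by exact_mod_cast (by omega : l + 1 ≤ p + 2)))
    have h2 := norm_integral_le_of_norm_le
      (((integrable_abs_pow hLp (k := p + 1 - l) (by omega)).div_const _).const_mul M)
      (.of_forall (hR l hl.le))
    rw [integral_const_mul, integral_div] at h2
    have h3 := integral_abs_pow_mul_le (a := l + 1) (b := p + 1 - l)
      (integrable_abs_pow hLp (by omega)) (integrable_abs_pow hLp (by omega))
      (integrable_abs_pow hLp (by omega))
    rw [show l + 1 + (p + 1 - l) = p + 2 by omega] at h3
    rw [norm_mul, norm_div, Complex.norm_natCast]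
    calc _ ≤ ((l : ℝ) + 1) ^ (l + 1) * (∫ ω, |ζ ω| ^ (l + 1)) / (l.factorial : ℝ)
          * (M * ((∫ ω, |ζ ω| ^ (p + 1 - l)) / ((p + 1 - l).factorial : ℝ))) := by gcongr
      _ = ((l : ℝ) + 1) ^ (l + 1) / (l.factorial : ℝ) * (M / ((p + 1 - l).factorial : ℝ))
          * ((∫ ω, |ζ ω| ^ (l + 1)) * ∫ ω, |ζ ω| ^ (p + 1 - l)) := by ring
      _ ≤ ((l : ℝ) + 1) ^ (l + 1) / (l.factorial : ℝ) * (M / ((p + 1 - l).factorial : ℝ))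
          * A := by gcongr
      _ = _ := by
        rw [Nat.cast_choose ℝ hl.le]
        have h4 : ((p + 1).factorial : ℝ) ≠ 0 := by exact_mod_cast (p + 1).factorial_ne_zero
        field_simp
  have hnum : ∑ l ∈ range (p + 1), ((p + 1).choose l : ℝ) * ((l : ℝ) + 1) ^ (l + 1)
      ≤ (3 + 2 * (p : ℝ)) ^ (p + 2) := by
    refine (sum_range_choose_mul_succ_pow_le (p + 1)).trans ?_
    rw [pow_succ' _ (p + 1)]
    push_cast
    have hp : (0 : ℝ) ≤ p := p.cast_nonneg
    exact mul_le_mul (by linarith) (pow_le_pow_left₀ (by linarith) (by linarith) _)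
      (by positivity) (by positivity)
  rw [hdiff]
  calc _ ≤ M / ((p + 1).factorial : ℝ) * A
        + ∑ l ∈ range (p + 1), ((p + 1).choose l : ℝ) * ((l : ℝ) + 1) ^ (l + 1)
          * (M * A / ((p + 1).factorial : ℝ)) := by
        refine (norm_sub_le _ _).trans (add_le_add ?_ (norm_sum_le_of_le _ hterm))
        rw [hA, ← integral_const_mul]
        exact norm_integral_le_of_norm_le (hmom.const_mul _) (.of_forall hR0)
    _ ≤ M / ((p + 1).factorial : ℝ) * A
        + (3 + 2 * (p : ℝ)) ^ (p + 2) * (M * A / ((p + 1).factorial : ℝ)) := by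
        rw [← sum_mul]
        gcongr
    _ = _ := by ring
end

section
/- Let w > 0 and let ρ_sc be the semicircle density, ρ_sc(λ) = (2πw²)^{−1} √(4w² − λ²) for |λ| ≤ 2w and ρ_sc(λ) = 0 otherwise. Define the Stieltjes transform ṽ(z) = ∫_{−2w}^{2w} ρ_sc(λ)/(λ − z) dλ for z ∈ ℂ with Im z ≠ 0. Then for every such z, w² ṽ(z)² + z ṽ(z) + 1 = 0. -/
open MeasureTheory Complex

/-- The semicircle density `ρ_sc(λ) = (2πw²)⁻¹ √(4w² - λ²)` (which vanishes for `|λ| > 2w`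
since `√` of a negative number is `0`). -/
noncomputable def semicircle (w : ℝ) (lam : ℝ) : ℝ :=
  (2 * Real.pi * w ^ 2)⁻¹ * Real.sqrt (4 * w ^ 2 - lam ^ 2)

/-- For `z` off the real axis, the equation `w (u + u⁻¹) = z` has a solution in the punctured
open unit disc. -/
theorem exists_norm_lt_one_joukowsky (w : ℝ) (hw : w ≠ 0) (z : ℂ) (hz : z.im ≠ 0) :
    ∃ u : ℂ, u ≠ 0 ∧ ‖u‖ < 1 ∧ z = w * (u + u⁻¹) := by
  have hw' : (w : ℂ) ≠ 0 := by exact_mod_cast hw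
  obtain ⟨s, hs⟩ := IsAlgClosed.exists_pow_nat_eq (z ^ 2 - 4 * (w : ℂ) ^ 2) (n := 2) two_pos
  have key : ∃ u : ℂ, w * u ^ 2 - z * u + w = 0 := by
    refine ⟨(z + s) / (2 * w), ?_⟩
    field_simp
    linear_combination hs
  obtain ⟨u, hu⟩ := key
  have hu0 : u ≠ 0 := by
    rintro rfl
    simp [hw] at hu
  have hzu : z = w * (u + u⁻¹) := by
    field_simp
    linear_combination -hu
  rcases lt_trichotomy ‖u‖ 1 with h | h | h
  · exact ⟨u, hu0, h, hzu⟩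
  · refine absurd ?_ hz
    rw [hzu, Complex.inv_eq_conj h, Complex.add_conj]
    simp
  · refine ⟨u⁻¹, inv_ne_zero hu0, ?_, ?_⟩
    · rw [norm_inv]
      exact inv_lt_one_of_one_lt₀ h
    · rw [inv_inv, hzu, add_comm]

/-- `1 + 2 u cos θ + u²` factors as `(1 + u e^{iθ}) (1 + u e^{-iθ})`. -/
theorem one_add_two_mul_cos_add_sq (u x : ℂ) :
    1 + 2 * u * Complex.cos x + u ^ 2 =
      (1 + u * Complex.exp (x * I)) * (1 + u * Complex.exp (-x * I)) := by
  have h : Complex.exp (x * I) * Complex.exp (-x * I) = 1 := by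
    rw [← Complex.exp_add]; simp
  rw [Complex.cos]
  linear_combination (-u ^ 2) * h

theorem norm_mul_exp_ofReal_mul_I (u : ℂ) (x : ℝ) : ‖u * Complex.exp (x * I)‖ = ‖u‖ := by
  rw [norm_mul, Complex.norm_exp_ofReal_mul_I, mul_one]

theorem one_add_two_mul_cos_add_sq_ne_zero {u : ℂ} (hu : ‖u‖ < 1) (x : ℝ) :
    1 + 2 * u * Complex.cos x + u ^ 2 ≠ 0 := by
  rw [one_add_two_mul_cos_add_sq]
  refine mul_ne_zero (slitPlane_ne_zero (mem_slitPlane_of_norm_lt_one ?_))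
    (slitPlane_ne_zero (mem_slitPlane_of_norm_lt_one ?_))
  · rwa [norm_mul_exp_ofReal_mul_I]
  · rwa [← ofReal_neg, norm_mul_exp_ofReal_mul_I]

/-- The integral `∫₀^π sin² θ / (1 + 2 u cos θ + u²) dθ` does not depend on `u` in the
punctured unit disc. -/
theorem integral_sin_sq_div_one_add_two_mul_cos_add_sq {u : ℂ} (hu0 : u ≠ 0) (hu : ‖u‖ < 1) :
    ∫ x in (0 : ℝ)..Real.pi, Complex.sin x ^ 2 / (1 + 2 * u * Complex.cos x + u ^ 2) =
      (Real.pi / 2 : ℂ) := by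
  let F : ℂ → ℂ := fun x => x / 2 - Complex.sin x / (2 * u) -
    I * ((1 - u ^ 2) / (4 * u ^ 2)) *
      (Complex.log (1 + u * Complex.exp (x * I)) - Complex.log (1 + u * Complex.exp (-x * I)))
  have hF : ∀ x : ℝ, HasDerivAt (fun t : ℝ => F t)
      (Complex.sin x ^ 2 / (1 + 2 * u * Complex.cos x + u ^ 2)) x := by
    intro x
    have h1 : 1 + u * Complex.exp (x * I) ∈ slitPlane :=
      mem_slitPlane_of_norm_lt_one (by rwa [norm_mul_exp_ofReal_mul_I])
    have h2 : 1 + u * Complex.exp (-x * I) ∈ slitPlane :=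
      mem_slitPlane_of_norm_lt_one (by rwa [← ofReal_neg, norm_mul_exp_ofReal_mul_I])
    have d1 := (((((hasDerivAt_id (x : ℂ)).mul_const I).cexp).const_mul u).const_add 1).clog h1
    have d2 := (((((hasDerivAt_id (x : ℂ)).neg.mul_const I).cexp).const_mul u).const_add 1).clog h2
    have d := (((hasDerivAt_id (x : ℂ)).div_const 2).sub
      ((Complex.hasDerivAt_sin (x : ℂ)).div_const (2 * u))).sub
      ((d1.sub d2).const_mul (I * ((1 - u ^ 2) / (4 * u ^ 2))))
    refine HasDerivAt.comp_ofReal (e := F) (d.congr_deriv ?_)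
    have hexp : Complex.exp (x * I) * Complex.exp (-x * I) = 1 := by
      rw [← Complex.exp_add]; simp
    have n1 := slitPlane_ne_zero h1
    have n2 := slitPlane_ne_zero h2
    rw [Complex.sin_sq, one_add_two_mul_cos_add_sq, Complex.cos]
    simp only [id, Pi.neg_apply]
    generalize Complex.exp (x * I) = e at *
    generalize Complex.exp (-x * I) = f at *
    obtain rfl : f = e⁻¹ := eq_inv_of_mul_eq_one_right hexp
    have he : e ≠ 0 := left_ne_zero_of_mul_eq_one hexp
    have n3 : e + u ≠ 0 := by
      intro h
      apply n2
      rw [← mul_inv_cancel₀ he, ← add_mul, h, zero_mul]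
    rw [mul_comm u] at n1 ⊢
    have hI : I ^ 2 = -1 := I_sq
    field_simp
    simp only [hI]
    ring
  have hcont : Continuous fun x : ℝ =>
      Complex.sin x ^ 2 / (1 + 2 * u * Complex.cos x + u ^ 2) := by
    refine Continuous.div (by fun_prop) (by fun_prop) ?_
    exact one_add_two_mul_cos_add_sq_ne_zero hu
  rw [intervalIntegral.integral_eq_sub_of_hasDerivAt (fun x _ => hF x)
    (hcont.intervalIntegrable _ _)]
  have hpi : Complex.exp (-(Real.pi : ℂ) * I) = -1 := by
    rw [neg_mul, Complex.exp_neg, Complex.exp_pi_mul_I]; norm_num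
  simp [F, hpi, -neg_mul]

/-- Integration against the semicircle density in the angular variable `λ = -2w cos θ`. -/
theorem integral_semicircle_div_sub (w : ℝ) (hw : 0 < w) (z : ℂ) (hz : z.im ≠ 0) :
    ∫ lam in (-(2*w))..(2*w), (semicircle w lam : ℂ) / (lam - z) =
      ∫ x in (0 : ℝ)..Real.pi,
        -(2 / Real.pi : ℂ) * (Complex.sin x ^ 2 / (2 * w * Complex.cos x + z)) := by
  have hne : ∀ t : ℝ, (t : ℂ) - z ≠ 0 := by
    intro t h
    apply hz
    simpa using congrArg Complex.im h
  have hcont : Continuous fun t : ℝ => (semicircle w t : ℂ) / (t - z) := by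
    refine Continuous.div ?_ (by fun_prop) hne
    unfold semicircle
    fun_prop
  have hsub := intervalIntegral.integral_deriv_smul_comp (a := 0) (b := Real.pi)
    (f := fun x => -(2 * w) * Real.cos x) (f' := fun x => -(2 * w) * -Real.sin x)
    (g := fun t : ℝ => (semicircle w t : ℂ) / (t - z))
    (fun x _ => (Real.hasDerivAt_cos x).const_mul _)
    (by fun_prop) hcont
  simp only [Real.cos_zero, Real.cos_pi, mul_one, mul_neg, neg_neg] at hsub
  rw [← hsub]
  refine intervalIntegral.integral_congr fun x hx => ?_
  rw [Set.uIcc_of_le Real.pi_pos.le] at hx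
  have hs := Real.sin_nonneg_of_nonneg_of_le_pi hx.1 hx.2
  have hsq : Real.sqrt (4 * w ^ 2 - (-(2 * w) * Real.cos x) ^ 2) = 2 * w * Real.sin x := by
    rw [← Real.sqrt_sq (by positivity : 0 ≤ 2 * w * Real.sin x)]
    congr 1
    linear_combination 4 * w ^ 2 * (Real.sin_sq_add_cos_sq x).symm
  have hn := hne (-(2 * w) * Real.cos x)
  have hn' : 2 * (w : ℂ) * Complex.cos x + z ≠ 0 := by
    intro h
    apply hn
    push_cast
    linear_combination -h
  have hw' : (w : ℂ) ≠ 0 := by exact_mod_cast hw.ne'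
  have hpi : (Real.pi : ℂ) ≠ 0 := by exact_mod_cast Real.pi_ne_zero
  have hden : ((-(2 * w) * Real.cos x : ℝ) : ℂ) - z = -(2 * w * Complex.cos x + z) := by
    push_cast; ring
  simp only [Function.comp_apply, semicircle, real_smul]
  rw [hsq, hden]
  push_cast
  field_simp

/-- The Stieltjes transform `ṽ(z) = ∫_{-2w}^{2w} ρ_sc(λ)/(λ - z) dλ` of the semicircle law
satisfies `w² ṽ(z)² + z ṽ(z) + 1 = 0` for every `z` with `Im z ≠ 0`. -/
theorem semicircle_stieltjes_quadratic (w : ℝ) (hw : 0 < w) (z : ℂ) (hz : z.im ≠ 0) :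
    (w ^ 2 : ℂ) * (∫ lam in (-(2*w))..(2*w), (semicircle w lam : ℂ) / (lam - z)) ^ 2
      + z * (∫ lam in (-(2*w))..(2*w), (semicircle w lam : ℂ) / (lam - z)) + 1 = 0 := by
  have hw' : (w : ℂ) ≠ 0 := by exact_mod_cast hw.ne'
  have hpi : (Real.pi : ℂ) ≠ 0 := by exact_mod_cast Real.pi_ne_zero
  obtain ⟨u, hu0, hu, hzu⟩ := exists_norm_lt_one_joukowsky w hw.ne' z hz
  have hv : ∫ lam in (-(2*w))..(2*w), (semicircle w lam : ℂ) / (lam - z) = -u / w := by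
    have hfun : ∀ x : ℝ,
        -(2 / Real.pi : ℂ) * (Complex.sin x ^ 2 / (2 * w * Complex.cos x + z)) =
        -(2 / Real.pi : ℂ) * (u / w) *
          (Complex.sin x ^ 2 / (1 + 2 * u * Complex.cos x + u ^ 2)) := by
      intro x
      have hd : 2 * w * Complex.cos x + z = w / u * (1 + 2 * u * Complex.cos x + u ^ 2) := by
        rw [hzu]
        field_simp
        ring
      have hD := one_add_two_mul_cos_add_sq_ne_zero hu x
      rw [hd]
      field_simp
    rw [integral_semicircle_div_sub w hw z hz]
    simp_rw [hfun]
    rw [intervalIntegral.integral_const_mul,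
      integral_sin_sq_div_one_add_two_mul_cos_add_sq hu0 hu]
    field_simp
  rw [hv, hzu]
  field_simp
  ring
end

section
/- Let w > 0, let ρ_sc be the semicircle density, and let v(t) = ∫_{−2w}^{2w} e^{itλ} ρ_sc(λ) dλ. Then v is differentiable on [0,∞), satisfies the integral equation v(t) + w² ∫₀ᵗ ∫₀^{t₁} v(t₁ − t₂) v(t₂) dt₂ dt₁ = 1 for all t ≥ 0, and moreover v is the unique differentiable function F₁ : [0,∞) → ℂ satisfying F₁(t) + w² ∫₀ᵗ ∫₀^{t₁} v(t₁ − t₂) F₁(t₂) dt₂ dt₁ = 1 for all t ≥ 0. -/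
open MeasureTheory Complex

/-- `v(t) = ∫_{-2w}^{2w} e^{itλ} ρ_sc(λ) dλ`, the Fourier transform of the semicircle law. -/
noncomputable def scFourier (w : ℝ) (t : ℝ) : ℂ :=
  ∫ lam in (-(2*w))..(2*w), Complex.exp (Complex.I * t * lam) * (semicircle w lam : ℂ)

open scoped Nat

/-- The moment integrals `∫ xⁿ √(r² - x²) dx` over `[-r, r]` satisfy a two-step recursion. -/
theorem integral_pow_mul_sqrt_sq_sub_sq_add_two (r : ℝ) (hr : 0 < r) (n : ℕ) :
    ((n : ℝ) + 4) * ∫ x in (-r)..r, x ^ (n + 2) * √(r ^ 2 - x ^ 2)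
      = (n + 1) * r ^ 2 * ∫ x in (-r)..r, x ^ n * √(r ^ 2 - x ^ 2) := by
  have key : ∫ x in (-r)..r, ((n + 1) * r ^ 2 * (x ^ n * √(r ^ 2 - x ^ 2))
      - ((n : ℝ) + 4) * (x ^ (n + 2) * √(r ^ 2 - x ^ 2))) = 0 := by
    rw [intervalIntegral.integral_eq_sub_of_hasDerivAt_of_le
      (f := fun x => x ^ (n + 1) * ((r ^ 2 - x ^ 2) * √(r ^ 2 - x ^ 2))) (by linarith)]
    · simp
    · fun_prop
    · intro x hx
      have hpos : 0 < r ^ 2 - x ^ 2 := by nlinarith [hx.1, hx.2]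
      have h1 : HasDerivAt (fun x : ℝ => r ^ 2 - x ^ 2) (-(2 * x)) x := by
        simpa using (hasDerivAt_pow 2 x).const_sub (r ^ 2)
      refine ((hasDerivAt_pow (n + 1) x).mul (h1.mul (h1.sqrt hpos.ne'))).congr_deriv ?_
      have hs : √(r ^ 2 - x ^ 2) ≠ 0 := (Real.sqrt_pos.2 hpos).ne'
      have hsq : √(r ^ 2 - x ^ 2) ^ 2 = r ^ 2 - x ^ 2 := Real.sq_sqrt hpos.le
      push_cast
      simp only [Pi.mul_apply]
      field_simp
      rw [hsq]
      ring
    · apply Continuous.intervalIntegrable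
      fun_prop
  rw [intervalIntegral.integral_sub, intervalIntegral.integral_const_mul,
    intervalIntegral.integral_const_mul] at key
  · linarith
  all_goals
    apply Continuous.intervalIntegrable
    fun_prop

theorem integral_sqrt_sq_sub_sq (r : ℝ) (hr : 0 < r) :
    ∫ x in (-r)..r, √(r ^ 2 - x ^ 2) = Real.pi * r ^ 2 / 2 := by
  have h := intervalIntegral.smul_integral_comp_mul_left
    (a := -1) (b := 1) (fun x => √(r ^ 2 - x ^ 2)) r
  have h2 : ∀ x : ℝ, √(r ^ 2 - (r * x) ^ 2) = r * √(1 - x ^ 2) := fun x => by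
    rw [show r ^ 2 - (r * x) ^ 2 = r ^ 2 * (1 - x ^ 2) by ring, Real.sqrt_mul (sq_nonneg r),
      Real.sqrt_sq hr.le]
  simp only [h2, mul_neg, mul_one, intervalIntegral.integral_const_mul,
    integral_sqrt_one_sub_sq, smul_eq_mul] at h
  rw [← h]
  ring

theorem continuous_semicircle (w : ℝ) : Continuous (semicircle w) := by
  unfold semicircle
  fun_prop

theorem semicircle_nonneg (w lam : ℝ) : 0 ≤ semicircle w lam := by
  unfold semicircle
  positivity

theorem integral_pow_mul_semicircle_odd (w : ℝ) (n : ℕ) (hn : Odd n) :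
    ∫ x in (-(2 * w))..(2 * w), x ^ n * semicircle w x = 0 := by
  have h := intervalIntegral.integral_comp_neg (a := -(2 * w)) (b := 2 * w)
    (fun x => x ^ n * semicircle w x)
  have hs : ∀ x, semicircle w (-x) = semicircle w x := fun x => by simp [semicircle]
  simp only [hn.neg_pow, hs, neg_neg, neg_mul, intervalIntegral.integral_neg] at h
  linarith

theorem integral_pow_mul_semicircle_even (w : ℝ) (hw : 0 < w) (k : ℕ) :
    ∫ x in (-(2 * w))..(2 * w), x ^ (2 * k) * semicircle w x = w ^ (2 * k) * catalan k := by
  have hform : ∀ n : ℕ, ∫ x in (-(2 * w))..(2 * w), x ^ n * semicircle w x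
      = (2 * Real.pi * w ^ 2)⁻¹ * ∫ x in (-(2 * w))..(2 * w), x ^ n * √((2 * w) ^ 2 - x ^ 2) := by
    intro n
    rw [← intervalIntegral.integral_const_mul]
    congr 1
    ext x
    rw [semicircle, show (2 * w) ^ 2 = 4 * w ^ 2 by ring]
    ring
  induction k with
  | zero =>
    rw [hform]
    simp only [mul_zero, pow_zero, one_mul, catalan_zero, Nat.cast_one]
    rw [integral_sqrt_sq_sub_sq (2 * w) (by linarith)]
    field_simp
  | succ k ih =>
    rw [hform] at ih ⊢
    have h := integral_pow_mul_sqrt_sq_sub_sq_add_two (2 * w) (by linarith) (2 * k)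
    have hc : ((k : ℝ) + 2) * catalan (k + 1) = 2 * (2 * k + 1) * catalan k := by
      have h1 := succ_mul_catalan_eq_centralBinom k
      have h2 := succ_mul_catalan_eq_centralBinom (k + 1)
      have h3 := Nat.succ_mul_centralBinom_succ k
      rw [← h1, ← h2] at h3
      have h4 : ((k : ℝ) + 1) * ((k + 2) * catalan (k + 1))
          = (k + 1) * (2 * (2 * k + 1) * catalan k) := by
        have := congrArg (Nat.cast (R := ℝ)) h3
        push_cast at this
        linarith
      exact mul_left_cancel₀ (by positivity) h4
    rw [show 2 * (k + 1) = 2 * k + 2 by ring]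
    push_cast at h
    have hk : (2 * (k : ℝ) + 4) ≠ 0 := by positivity
    apply mul_left_cancel₀ hk
    rw [mul_left_comm, h]
    calc _ = (2 * (k : ℝ) + 1) * (2 * w) ^ 2 * ((2 * Real.pi * w ^ 2)⁻¹ *
          ∫ x in (-(2 * w))..(2 * w), x ^ (2 * k) * √((2 * w) ^ 2 - x ^ 2)) := by ring
      _ = w ^ (2 * k + 2) * 2 * (2 * (2 * k + 1) * catalan k) := by rw [ih]; ring
      _ = _ := by rw [← hc]; ring

theorem hasSum_scFourier_moments (w : ℝ) (hw : 0 < w) (t : ℝ) :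
    HasSum (fun n : ℕ => (I * t) ^ n / (n ! : ℂ) *
      ((∫ x in (-(2 * w))..(2 * w), x ^ n * semicircle w x : ℝ) : ℂ)) (scFourier w t) := by
  have hρ := continuous_semicircle w
  have h := intervalIntegral.hasSum_integral_of_dominated_convergence
    (μ := volume) (a := -(2 * w)) (b := 2 * w)
    (F := fun (n : ℕ) x => (I * t * x) ^ n / (n ! : ℂ) * (semicircle w x : ℂ))
    (f := fun x => Complex.exp (I * t * x) * (semicircle w x : ℂ))
    (fun n x => (|t| * (2 * w)) ^ n / n ! * semicircle w x) ?_ ?_ ?_ ?_ ?_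
  · refine h.congr_fun fun n => ?_
    rw [← intervalIntegral.integral_ofReal, ← intervalIntegral.integral_const_mul]
    congr 1
    ext x
    push_cast
    ring
  · intro n
    apply Continuous.aestronglyMeasurable
    fun_prop
  · refine fun n => Filter.Eventually.of_forall fun x hx => ?_
    rw [Set.uIoc_of_le (by linarith)] at hx
    have hx' : |x| ≤ 2 * w := abs_le.2 ⟨hx.1.le, hx.2⟩
    simp only [norm_mul, norm_div, norm_pow, norm_I, one_mul, norm_real, Real.norm_eq_abs,
      Complex.norm_natCast, abs_of_nonneg (semicircle_nonneg w x)]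
    have := semicircle_nonneg w x
    gcongr
  · exact Filter.Eventually.of_forall fun x _ =>
      (Real.summable_pow_div_factorial _).mul_right _
  · simp only [tsum_mul_right]
    apply Continuous.intervalIntegrable
    fun_prop
  · refine Filter.Eventually.of_forall fun x _ => HasSum.mul_right _ ?_
    rw [Complex.exp_eq_exp_ℂ]
    exact NormedSpace.expSeries_div_hasSum_exp _

/-- The Taylor expansion of `v` has the signed Catalan numbers as even coefficients. -/
theorem hasSum_scFourier (w : ℝ) (hw : 0 < w) (t : ℝ) :
    HasSum (fun k : ℕ => (((-w ^ 2) ^ k * catalan k * (t ^ (2 * k) / (2 * k)!) : ℝ) : ℂ))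
      (scFourier w t) := by
  have h := hasSum_scFourier_moments w hw t
  rw [← Function.Injective.hasSum_iff (g := fun k : ℕ => 2 * k)
    (mul_right_injective₀ two_ne_zero)] at h
  · refine h.congr_fun fun k => ?_
    symm
    simp only [Function.comp]
    rw [integral_pow_mul_semicircle_even w hw, mul_pow, pow_mul I, I_sq, neg_pow]
    push_cast
    ring
  · intro n hn
    rw [integral_pow_mul_semicircle_odd]
    · simp
    · by_contra hodd
      obtain ⟨k, hk⟩ := (Nat.not_odd_iff_even.1 hodd).two_dvd
      exact hn ⟨k, hk.symm⟩

theorem continuous_scFourier (w : ℝ) : Continuous (scFourier w) := by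
  have hρ := continuous_semicircle w
  unfold scFourier
  apply intervalIntegral.continuous_parametric_intervalIntegral_of_continuous'
  simp only [Function.uncurry_def]
  fun_prop

/-- The beta integral at natural parameters, normalised by factorials. -/
theorem integral_sub_pow_mul_pow_div_factorial (p q : ℕ) (t : ℝ) :
    ∫ s in (0 : ℝ)..t, (t - s) ^ p / p ! * (s ^ q / q !) = t ^ (p + q + 1) / (p + q + 1)! := by
  have hderiv : ∀ (m : ℕ) (s : ℝ),
      HasDerivAt (fun s : ℝ => s ^ (m + 1) / (m + 1)!) (s ^ m / m !) s := by
    intro m s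
    refine ((hasDerivAt_pow (m + 1) s).div_const ((m + 1)! : ℝ)).congr_deriv ?_
    rw [Nat.factorial_succ]
    push_cast
    have : (m ! : ℝ) ≠ 0 := by positivity
    field_simp
  induction p generalizing q with
  | zero =>
    simp only [pow_zero, Nat.factorial_zero, Nat.cast_one, div_one, one_mul, zero_add]
    rw [intervalIntegral.integral_eq_sub_of_hasDerivAt (fun s _ => hderiv q s)]
    · simp
    · apply Continuous.intervalIntegrable
      fun_prop
  | succ p ih =>
    have key : ∫ s in (0 : ℝ)..t, ((t - s) ^ (p + 1) / (p + 1)! * (s ^ q / q !)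
        - (t - s) ^ p / p ! * (s ^ (q + 1) / (q + 1)!)) = 0 := by
      rw [intervalIntegral.integral_eq_sub_of_hasDerivAt
        (f := fun s => (t - s) ^ (p + 1) / (p + 1)! * (s ^ (q + 1) / (q + 1)!))]
      · simp
      · intro s _
        refine (((hderiv p (t - s)).comp_const_sub t s).mul (hderiv q s)).congr_deriv ?_
        ring
      · apply Continuous.intervalIntegrable
        fun_prop
    rw [intervalIntegral.integral_sub, sub_eq_zero, ih] at key
    · rw [key, show p + 1 + q + 1 = p + (q + 1) + 1 by ring]
    all_goals
      apply Continuous.intervalIntegrable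
      fun_prop

theorem hasSum_mul_prod {u v : ℕ → ℂ} {A B : ℂ} (hu : HasSum u A) (hv : HasSum v B) :
    HasSum (fun p : ℕ × ℕ => u p.1 * v p.2) (A * B) :=
  hu.mul hv (summable_mul_of_summable_norm hu.summable.norm hv.summable.norm)

/-- Termwise self-convolution of an even power series. -/
theorem hasSum_integral_conv {a : ℕ → ℝ} {f : ℝ → ℂ}
    (hf : ∀ t, HasSum (fun k : ℕ => ((a k * (t ^ (2 * k) / (2 * k)!) : ℝ) : ℂ)) (f t))
    {t : ℝ} (ht : 0 ≤ t) :
    HasSum (fun p : ℕ × ℕ => ((a p.1 * a p.2 *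
        (t ^ (2 * p.1 + 2 * p.2 + 1) / (2 * p.1 + 2 * p.2 + 1)!) : ℝ) : ℂ))
      (∫ s in (0 : ℝ)..t, f (t - s) * f s) := by
  have hsum : ∀ s, Summable fun k : ℕ => ‖((a k * (s ^ (2 * k) / (2 * k)!) : ℝ) : ℂ)‖ :=
    fun s => (hf s).summable.norm
  have hle : ∀ s ∈ Set.Icc 0 t, ∀ k : ℕ, ‖((a k * (s ^ (2 * k) / (2 * k)!) : ℝ) : ℂ)‖
      ≤ ‖((a k * (t ^ (2 * k) / (2 * k)!) : ℝ) : ℂ)‖ := by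
    intro s hs k
    simp only [norm_real, norm_mul, norm_div, norm_pow]
    have : ‖s‖ ≤ ‖t‖ := by
      rw [Real.norm_of_nonneg hs.1, Real.norm_of_nonneg ht]
      exact hs.2
    gcongr
  have h := intervalIntegral.hasSum_integral_of_dominated_convergence
    (μ := volume) (a := 0) (b := t)
    (F := fun (p : ℕ × ℕ) s => ((a p.1 * ((t - s) ^ (2 * p.1) / (2 * p.1)!) : ℝ) : ℂ)
      * ((a p.2 * (s ^ (2 * p.2) / (2 * p.2)!) : ℝ) : ℂ))
    (f := fun s => f (t - s) * f s)
    (fun p _ => ‖((a p.1 * (t ^ (2 * p.1) / (2 * p.1)!) : ℝ) : ℂ)‖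
      * ‖((a p.2 * (t ^ (2 * p.2) / (2 * p.2)!) : ℝ) : ℂ)‖) ?_ ?_ ?_ ?_ ?_
  · refine h.congr_fun fun p => ?_
    rw [← integral_sub_pow_mul_pow_div_factorial, ← intervalIntegral.integral_const_mul,
      ← intervalIntegral.integral_ofReal]
    congr 1
    ext s
    push_cast
    ring
  · intro p
    apply Continuous.aestronglyMeasurable
    fun_prop
  · refine fun p => Filter.Eventually.of_forall fun s hs => ?_
    rw [Set.uIoc_of_le ht] at hs
    rw [norm_mul]
    exact mul_le_mul (hle _ ⟨by linarith [hs.2], by linarith [hs.1]⟩ _)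
      (hle _ ⟨hs.1.le, hs.2⟩ _) (norm_nonneg _) (norm_nonneg _)
  · exact Filter.Eventually.of_forall fun s _ =>
      (hsum t).mul_of_nonneg (hsum t) (fun _ => norm_nonneg _) (fun _ => norm_nonneg _)
  · exact intervalIntegrable_const
  · refine Filter.Eventually.of_forall fun s _ => ?_
    have hprod := hasSum_mul_prod (hf (t - s)) (hf s)
    exact hprod

theorem hasSum_integral_integral_conv {a : ℕ → ℝ} {f : ℝ → ℂ}
    (hf : ∀ t, HasSum (fun k : ℕ => ((a k * (t ^ (2 * k) / (2 * k)!) : ℝ) : ℂ)) (f t))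
    {t : ℝ} (ht : 0 ≤ t) :
    HasSum (fun p : ℕ × ℕ => ((a p.1 * a p.2 *
        (t ^ (2 * p.1 + 2 * p.2 + 2) / (2 * p.1 + 2 * p.2 + 2)!) : ℝ) : ℂ))
      (∫ t₁ in (0 : ℝ)..t, ∫ s in (0 : ℝ)..t₁, f (t₁ - s) * f s) := by
  have hsum := (hasSum_integral_conv hf ht).summable.norm
  have h := intervalIntegral.hasSum_integral_of_dominated_convergence
    (μ := volume) (a := 0) (b := t)
    (F := fun (p : ℕ × ℕ) s => ((a p.1 * a p.2 *
        (s ^ (2 * p.1 + 2 * p.2 + 1) / (2 * p.1 + 2 * p.2 + 1)!) : ℝ) : ℂ))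
    (f := fun t₁ => ∫ s in (0 : ℝ)..t₁, f (t₁ - s) * f s)
    (fun p _ => ‖((a p.1 * a p.2 *
        (t ^ (2 * p.1 + 2 * p.2 + 1) / (2 * p.1 + 2 * p.2 + 1)!) : ℝ) : ℂ)‖) ?_ ?_ ?_ ?_ ?_
  · refine h.congr_fun fun p => ?_
    have hi := integral_sub_pow_mul_pow_div_factorial 0 (2 * p.1 + 2 * p.2 + 1) t
    simp only [pow_zero, Nat.factorial_zero, Nat.cast_one, div_one, one_mul, zero_add] at hi
    rw [intervalIntegral.integral_ofReal, intervalIntegral.integral_const_mul, hi]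
  · intro p
    apply Continuous.aestronglyMeasurable
    fun_prop
  · refine fun p => Filter.Eventually.of_forall fun s hs => ?_
    rw [Set.uIoc_of_le ht] at hs
    have : ‖s‖ ≤ ‖t‖ := by
      rw [Real.norm_of_nonneg hs.1.le, Real.norm_of_nonneg ht]
      exact hs.2
    simp only [norm_real, norm_mul, norm_div, norm_pow]
    gcongr
  · exact Filter.Eventually.of_forall fun s _ => hsum
  · exact intervalIntegrable_const
  · refine Filter.Eventually.of_forall fun s hs => ?_
    rw [Set.uIoc_of_le ht] at hs
    exact hasSum_integral_conv hf hs.1.le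

theorem scFourier_add_integral_conv (w : ℝ) (hw : 0 < w) {t : ℝ} (ht : 0 ≤ t) :
    scFourier w t + (w ^ 2 : ℂ) * ∫ t₁ in (0 : ℝ)..t, ∫ t₂ in (0 : ℝ)..t₁,
      scFourier w (t₁ - t₂) * scFourier w t₂ = 1 := by
  have hv := hasSum_scFourier w hw
  have h2 := (hasSum_integral_integral_conv hv ht).mul_left (w ^ 2 : ℂ)
  rw [← Finset.HasAntidiagonal.sigmaAntidiagonalEquivProd.hasSum_iff] at h2
  have h3 := h2.sigma (fun n => hasSum_fintype _)
  have h4 := (hasSum_nat_add_iff' 1).2 (hv t)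
  have h5 := h4.add h3
  have h6 : ∀ n : ℕ, (((-w ^ 2) ^ (n + 1) * catalan (n + 1) *
        (t ^ (2 * (n + 1)) / (2 * (n + 1))!) : ℝ) : ℂ)
      + ∑ p : Finset.HasAntidiagonal.antidiagonal n, (w ^ 2 : ℂ) * (((-w ^ 2) ^ p.1.1 * catalan p.1.1 *
        ((-w ^ 2) ^ p.1.2 * catalan p.1.2) *
        (t ^ (2 * p.1.1 + 2 * p.1.2 + 2) / (2 * p.1.1 + 2 * p.1.2 + 2)!) : ℝ) : ℂ) = 0 := by
    intro n
    rw [Finset.sum_coe_sort (Finset.HasAntidiagonal.antidiagonal n) (fun p : ℕ × ℕ =>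
      (w ^ 2 : ℂ) * (((-w ^ 2) ^ p.1 * catalan p.1 * ((-w ^ 2) ^ p.2 * catalan p.2) *
        (t ^ (2 * p.1 + 2 * p.2 + 2) / (2 * p.1 + 2 * p.2 + 2)!) : ℝ) : ℂ))]
    have hterm : ∀ p ∈ Finset.HasAntidiagonal.antidiagonal n,
        (w ^ 2 : ℂ) * (((-w ^ 2) ^ p.1 * catalan p.1 * ((-w ^ 2) ^ p.2 * catalan p.2) *
          (t ^ (2 * p.1 + 2 * p.2 + 2) / (2 * p.1 + 2 * p.2 + 2)!) : ℝ) : ℂ)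
        = ((-((-w ^ 2) ^ (n + 1) * (t ^ (2 * (n + 1)) / (2 * (n + 1))!)) : ℝ) : ℂ)
          * ((catalan p.1 * catalan p.2 : ℕ) : ℂ) := by
      intro p hp
      rw [Finset.HasAntidiagonal.mem_antidiagonal] at hp
      subst hp
      rw [show 2 * p.1 + 2 * p.2 + 2 = 2 * (p.1 + p.2 + 1) by ring]
      push_cast
      ring
    rw [Finset.sum_congr rfl hterm, ← Finset.mul_sum, ← Nat.cast_sum, ← catalan_succ']
    push_cast
    ring
  have h7 := (h5.congr_fun fun n => (h6 n).symm).unique hasSum_zero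
  simp only [Finset.sum_range_one, pow_zero, catalan_zero, mul_zero, Nat.factorial_zero] at h7
  push_cast at h7
  linear_combination h7

/-- A continuous solution of the homogeneous Volterra equation with kernel `K` vanishes. -/
theorem eq_zero_of_add_integral_conv_eq_zero {K D : ℝ → ℂ} (hK : Continuous K)
    (hD : Continuous D) (c : ℂ)
    (h : ∀ t : ℝ, 0 ≤ t →
      D t + c * ∫ t₁ in (0 : ℝ)..t, ∫ t₂ in (0 : ℝ)..t₁, K (t₁ - t₂) * D t₂ = 0)
    {t : ℝ} (ht : 0 ≤ t) : D t = 0 := by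
  obtain ⟨B, hB⟩ := isCompact_Icc.exists_bound_of_continuousOn (s := Set.Icc 0 t) hK.continuousOn
  have hB0 : 0 ≤ B := (norm_nonneg _).trans (hB 0 ⟨le_rfl, ht⟩)
  set Φ : ℝ → ℝ := fun x => ∫ s in (0 : ℝ)..x, ‖D s‖ with hΦ
  have hint : ∀ x y : ℝ, IntervalIntegrable (fun s => ‖D s‖) volume x y :=
    fun x y => hD.norm.intervalIntegrable x y
  have hΦderiv : ∀ x, HasDerivAt Φ ‖D x‖ x := fun x => hD.norm.integral_hasStrictDerivAt 0 x
    |>.hasDerivAt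
  have hΦnonneg : ∀ x, 0 ≤ x → 0 ≤ Φ x := fun x hx =>
    intervalIntegral.integral_nonneg hx fun _ _ => norm_nonneg _
  have hΦmono : ∀ x y, 0 ≤ x → x ≤ y → Φ x ≤ Φ y := fun x y hx hxy =>
    intervalIntegral.integral_mono_interval le_rfl hx hxy
      (Filter.Eventually.of_forall fun _ => norm_nonneg _) (hint 0 y)
  have hbound : ∀ x ∈ Set.Icc 0 t, ‖D x‖ ≤ ‖c‖ * (B * t) * Φ x := by
    intro x hx
    have hinner : ∀ t₁ ∈ Set.uIoc 0 x, ‖∫ t₂ in (0 : ℝ)..t₁, K (t₁ - t₂) * D t₂‖ ≤ B * Φ x := by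
      intro t₁ ht₁
      rw [Set.uIoc_of_le hx.1] at ht₁
      calc _ ≤ ∫ t₂ in (0 : ℝ)..t₁, B * ‖D t₂‖ := by
            refine intervalIntegral.norm_integral_le_of_norm_le ht₁.1.le
              (Filter.Eventually.of_forall fun s hs => ?_) ((hint 0 t₁).const_mul B)
            rw [norm_mul]
            exact mul_le_mul_of_nonneg_right
              (hB _ ⟨by linarith [hs.2], by linarith [hs.1, ht₁.2, hx.2]⟩) (norm_nonneg _)
        _ = B * Φ t₁ := intervalIntegral.integral_const_mul _ _
        _ ≤ B * Φ x := mul_le_mul_of_nonneg_left (hΦmono _ _ ht₁.1.le ht₁.2) hB0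
    have houter := intervalIntegral.norm_integral_le_of_norm_le_const hinner
    rw [sub_zero, abs_of_nonneg hx.1] at houter
    rw [eq_neg_of_add_eq_zero_left (h x hx.1), norm_neg, norm_mul, mul_assoc]
    refine mul_le_mul_of_nonneg_left (houter.trans ?_) (norm_nonneg _)
    have := mul_le_mul_of_nonneg_left hx.2 (mul_nonneg hB0 (hΦnonneg x hx.1))
    linarith
  have hgr := norm_le_gronwallBound_of_norm_deriv_right_le (f := Φ) (f' := fun x => ‖D x‖)
    (δ := 0) (K := ‖c‖ * (B * t)) (ε := 0) (a := 0) (b := t)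
    (fun x _ => (hΦderiv x).continuousAt.continuousWithinAt)
    (fun x _ => (hΦderiv x).hasDerivWithinAt) (by simp [hΦ])
    (fun x hx => by
      have hx' : x ∈ Set.Icc 0 t := ⟨hx.1, hx.2.le⟩
      rw [norm_norm, add_zero, Real.norm_of_nonneg (hΦnonneg x hx.1)]
      exact hbound x hx') t ⟨ht, le_rfl⟩
  rw [gronwallBound_ε0_δ0, norm_le_zero_iff] at hgr
  have := hbound t ⟨ht, le_rfl⟩
  rwa [hgr, mul_zero, norm_le_zero_iff] at this

/-- `v` is differentiable on `[0,∞)`, satisfies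
`v(t) + w² ∫₀ᵗ∫₀^{t₁} v(t₁-t₂)v(t₂) dt₂ dt₁ = 1` for `t ≥ 0`, and is the unique differentiable
solution `F₁` of `F₁(t) + w² ∫₀ᵗ∫₀^{t₁} v(t₁-t₂)F₁(t₂) dt₂ dt₁ = 1` on `[0,∞)`. -/
theorem scFourier_integral_equation (w : ℝ) (hw : 0 < w) :
    DifferentiableOn ℝ (scFourier w) (Set.Ici 0)
    ∧ (∀ t : ℝ, 0 ≤ t →
        scFourier w t
          + (w ^ 2 : ℂ) * ∫ t₁ in (0:ℝ)..t, ∫ t₂ in (0:ℝ)..t₁,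
              scFourier w (t₁ - t₂) * scFourier w t₂ = 1)
    ∧ ∀ F : ℝ → ℂ, DifferentiableOn ℝ F (Set.Ici 0) →
        (∀ t : ℝ, 0 ≤ t →
          F t + (w ^ 2 : ℂ) * ∫ t₁ in (0:ℝ)..t, ∫ t₂ in (0:ℝ)..t₁,
              scFourier w (t₁ - t₂) * F t₂ = 1) →
        ∀ t : ℝ, 0 ≤ t → F t = scFourier w t := by
  have hv := continuous_scFourier w
  have hconv : Continuous fun t₁ : ℝ =>
      ∫ t₂ in (0 : ℝ)..t₁, scFourier w (t₁ - t₂) * scFourier w t₂ := by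
    apply intervalIntegral.continuous_parametric_intervalIntegral_of_continuous _ continuous_id
    simp only [Function.uncurry_def]
    fun_prop
  refine ⟨?_, fun t ht => scFourier_add_integral_conv w hw ht, fun F hF hFeq t ht => ?_⟩
  · have hdiff : Differentiable ℝ fun t : ℝ => 1 - (w ^ 2 : ℂ) *
        ∫ t₁ in (0 : ℝ)..t, ∫ t₂ in (0 : ℝ)..t₁, scFourier w (t₁ - t₂) * scFourier w t₂ :=
      fun t => (((hconv.integral_hasStrictDerivAt 0 t).hasDerivAt.const_mul _).const_sub
        _).differentiableAt
    exact hdiff.differentiableOn.congr fun t ht =>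
      eq_sub_of_add_eq (scFourier_add_integral_conv w hw ht)
  · have hG : Continuous fun s : ℝ => F (max s 0) :=
      hF.continuousOn.comp_continuous (by fun_prop) fun s => le_max_right s 0
    have hGconv : Continuous fun t₁ : ℝ =>
        ∫ t₂ in (0 : ℝ)..t₁, scFourier w (t₁ - t₂) * F (max t₂ 0) := by
      apply intervalIntegral.continuous_parametric_intervalIntegral_of_continuous _ continuous_id
      simp only [Function.uncurry_def]
      exact (hv.comp (by fun_prop)).mul (hG.comp continuous_snd)
    have hzero := eq_zero_of_add_integral_conv_eq_zero hv (hG.sub hv) (w ^ 2 : ℂ)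
      (fun x hx => ?_) ht
    · simpa [max_eq_left ht, sub_eq_zero] using hzero
    have hinner : ∀ t₁ : ℝ, ∫ t₂ in (0 : ℝ)..t₁,
        scFourier w (t₁ - t₂) * (F (max t₂ 0) - scFourier w t₂)
        = (∫ t₂ in (0 : ℝ)..t₁, scFourier w (t₁ - t₂) * F (max t₂ 0))
          - ∫ t₂ in (0 : ℝ)..t₁, scFourier w (t₁ - t₂) * scFourier w t₂ := by
      intro t₁
      simp only [mul_sub]
      apply intervalIntegral.integral_sub
      · exact ((hv.comp (by fun_prop)).mul hG).intervalIntegrable _ _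
      · exact ((hv.comp (by fun_prop)).mul hv).intervalIntegrable _ _
    have hmax : ∫ t₁ in (0 : ℝ)..x, ∫ t₂ in (0 : ℝ)..t₁, scFourier w (t₁ - t₂) * F (max t₂ 0)
        = ∫ t₁ in (0 : ℝ)..x, ∫ t₂ in (0 : ℝ)..t₁, scFourier w (t₁ - t₂) * F t₂ := by
      refine intervalIntegral.integral_congr fun t₁ ht₁ =>
        intervalIntegral.integral_congr fun t₂ ht₂ => ?_
      rw [Set.uIcc_of_le hx] at ht₁
      rw [Set.uIcc_of_le ht₁.1] at ht₂
      simp only [max_eq_left ht₂.1]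
    simp only [hinner, Pi.sub_apply]
    rw [intervalIntegral.integral_sub (hGconv.intervalIntegrable _ _)
      (hconv.intervalIntegrable _ _), hmax, max_eq_left hx]
    linear_combination hFeq x hx - scFourier_add_integral_conv w hw hx
end
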